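/- For every complete NBW A over Σ with n states, there exists an NBW B over Σ with at most 2^n · (2n+2)^n states such that L(B) = Σ^ω ∖ L(A). -/

import Mathlib

open scoped Classical

/-- A nondeterministic Büchi automaton on ω-words with states `Q` over alphabet `σ`. -/
structure NBW (σ : Type) (Q : Type) where
  init : Set Q
  trans : Q → σ → Set Q
  acc : Set Q

namespace NBW

variable {σ Q : Type}

/-- `ρ` is a run of `A` on the ω-word `w`. -/
def IsRun (A : NBW σ Q) (w : ℕ → σ) (ρ : ℕ → Q) : Prop :=
  ρ 0 ∈ A.init ∧ ∀ i, ρ (i + 1) ∈ A.trans (ρ i) (w i)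

/-- `ρ` is an accepting run of `A` on `w`: it visits `A.acc` infinitely often. -/
def IsAccRun (A : NBW σ Q) (w : ℕ → σ) (ρ : ℕ → Q) : Prop :=
  A.IsRun w ρ ∧ ∀ n, ∃ m, n ≤ m ∧ ρ m ∈ A.acc

/-- The ω-language accepted by `A`. -/
def Lang (A : NBW σ Q) : Set (ℕ → σ) := {w | ∃ ρ, A.IsAccRun w ρ}

/-- `A` is complete: every state has a successor on every letter. -/
def Complete (A : NBW σ Q) : Prop := ∀ q a, (A.trans q a).Nonempty

/-- `A` is finitely ambiguous: every accepted word has finitely many accepting runs. -/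
def FinitelyAmbiguous (A : NBW σ Q) : Prop :=
  ∀ w ∈ A.Lang, {ρ | A.IsAccRun w ρ}.Finite

/-- `A` is limit deterministic with partition `(QN, QD)`. -/
def LimitDetPart (A : NBW σ Q) (QN QD : Set Q) : Prop :=
  Disjoint QN QD ∧ QN ∪ QD = Set.univ ∧ A.acc ⊆ QD ∧
    ∀ q ∈ QD, ∀ a, ∃ q' ∈ QD, A.trans q a = {q'}

/-- `A` is limit deterministic (for some partition). -/
def LimitDet (A : NBW σ Q) : Prop := ∃ QN QD, A.LimitDetPart QN QD

end NBW

namespace NBW.Aux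

lemma pigeon {Q : Type} [Finite Q] (R : Q → ℕ → Prop) (hanti : ∀ q j, R q (j + 1) → R q j)
    (h : ∀ j, ∃ q, R q j) : ∃ q, ∀ j, R q j := by
  by_contra hcon
  push Not at hcon
  choose J hJ using hcon
  have hmono : ∀ q i j, i ≤ j → R q j → R q i := by
    intro q i j hij
    induction j, hij using Nat.le_induction with
    | base => exact id
    | succ j _ ih => exact fun hh => ih (hanti q j hh)
  have hfin : BddAbove (Set.range J) := (Set.finite_range J).bddAbove
  obtain ⟨b, hb⟩ := hfin
  obtain ⟨q, hq⟩ := h b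
  exact hJ q (hmono q _ _ (hb ⟨q, rfl⟩) hq)

/-- vertices of level `k` with a forward path of length `j` -/
def T {Q : Type} (S : ℕ → Set Q) (E : ℕ → Q → Q → Prop) : ℕ → ℕ → Q → Prop
  | 0, k, q => q ∈ S k
  | j + 1, k, q => q ∈ S k ∧ ∃ q', E k q q' ∧ T S E j (k + 1) q'

lemma konig {Q : Type} [Finite Q] (S : ℕ → Set Q) (E : ℕ → Q → Q → Prop)
    (hne : ∀ k, (S k).Nonempty) (hpred : ∀ k, ∀ q' ∈ S (k + 1), ∃ q ∈ S k, E k q q') :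
    ∃ ρ : ℕ → Q, (∀ k, ρ k ∈ S k) ∧ ∀ k, E k (ρ k) (ρ (k + 1)) := by
  have hS : ∀ j k q, T S E j k q → q ∈ S k := by
    intro j k q h
    cases j with
    | zero => exact h
    | succ j => exact h.1
  have hanti : ∀ j k q, T S E (j + 1) k q → T S E j k q := by
    intro j
    induction j with
    | zero => intro k q h; exact h.1
    | succ j ih =>
      intro k q h
      obtain ⟨h1, q', h2, h3⟩ := h
      exact ⟨h1, q', h2, ih _ _ h3⟩
  have hex : ∀ j k, ∃ q, T S E j k q := by
    intro j
    induction j with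
    | zero => intro k; exact hne k
    | succ j ih =>
      intro k
      obtain ⟨q', hq'⟩ := ih (k + 1)
      obtain ⟨q, hq, he⟩ := hpred k q' (hS _ _ _ hq')
      exact ⟨q, hq, q', he, hq'⟩
  obtain ⟨q0, hq0⟩ := pigeon (fun q j => T S E j 0 q) (fun q j => hanti j 0 q) (fun j => hex j 0)
  have hstep : ∀ k q, (∀ j, T S E j k q) → ∃ q', E k q q' ∧ ∀ j, T S E j (k + 1) q' := by
    intro k q h
    obtain ⟨q', hq'⟩ := pigeon (fun q' j => E k q q' ∧ T S E j (k + 1) q')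
      (fun q' j hh => ⟨hh.1, hanti _ _ _ hh.2⟩) (fun j => (h (j + 1)).2)
    exact ⟨q', (hq' 0).1, fun j => (hq' j).2⟩
  choose! nx hnx using hstep
  let ρ : ℕ → Q := fun k => Nat.rec q0 (fun k q => nx k q) k
  have hρ : ∀ k, ∀ j, T S E j k (ρ k) := by
    intro k
    induction k with
    | zero => exact hq0
    | succ k ih => exact (hnx k _ ih).2
  exact ⟨ρ, fun k => hρ k 0, fun k => (hnx k _ (hρ k)).1⟩

lemma stab (a : ℕ → ℕ) (M : ℕ) (h : ∀ k, M ≤ k → a (k + 1) ≤ a k) :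
    ∃ N, M ≤ N ∧ ∀ k, N ≤ k → a k = a N := by
  have hP : ∃ v, ∃ N, M ≤ N ∧ a N = v := ⟨_, M, le_rfl, rfl⟩
  obtain ⟨N, hMN, hN⟩ := Nat.find_spec hP
  refine ⟨N, hMN, fun k hk => le_antisymm ?_ ?_⟩
  · induction k, hk using Nat.le_induction with
    | base => exact le_rfl
    | succ k hk ih => exact (h k (hMN.trans hk)).trans ih
  · rw [hN]
    exact Nat.find_min' hP ⟨k, hMN.trans hk, rfl⟩

section DAG
variable {Q : Type} (I F : Set Q) (E : ℕ → Q → Q → Prop)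

/-- reachable vertices of the run DAG -/
def Reach : ℕ → Set Q
  | 0 => I
  | k + 1 => {q' | ∃ q ∈ Reach k, E k q q'}

/-- vertices of `G` from which an infinite path within `G` starts -/
def InfP (G : ℕ → Set Q) (k : ℕ) : Set Q :=
  {q | ∃ ρ : ℕ → Q, ρ k = q ∧ ∀ i, k ≤ i → ρ i ∈ G i ∧ E i (ρ i) (ρ (i + 1))}

/-- vertices of `G` reaching `F` within `G` in `d` steps -/
def FR (G : ℕ → Set Q) : ℕ → ℕ → Q → Prop
  | 0, k, q => q ∈ G k ∧ q ∈ F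
  | d + 1, k, q => q ∈ G k ∧ ∃ r, E k q r ∧ FR G d (k + 1) r

/-- the decreasing chain of sub-DAGs -/
def G : ℕ → ℕ → Set Q
  | 0 => Reach I E
  | j + 1 => if Even j then InfP E (G j) else fun k => {q | ∃ d, FR F E (G j) d k q}

lemma FR_mem {H : ℕ → Set Q} {d k : ℕ} {q : Q} (h : FR F E H d k q) : q ∈ H k := by
  cases d with
  | zero => exact h.1
  | succ d => exact h.1

lemma G_even {j : ℕ} (hj : Even j) : G I F E (j + 1) = InfP E (G I F E j) := by
  simp [G, hj]

lemma G_odd {j : ℕ} (hj : ¬ Even j) :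
    G I F E (j + 1) = fun k => {q | ∃ d, FR F E (G I F E j) d k q} := by
  simp [G, hj]

lemma G_succ (j k : ℕ) : G I F E (j + 1) k ⊆ G I F E j k := by
  intro q hq
  by_cases hj : Even j
  · rw [G_even I F E hj] at hq
    obtain ⟨ρ, rfl, h⟩ := hq
    exact (h k le_rfl).1
  · rw [G_odd I F E hj] at hq
    obtain ⟨d, hd⟩ := hq
    exact FR_mem F E hd

lemma G_anti {i j : ℕ} (hij : i ≤ j) (k : ℕ) : G I F E j k ⊆ G I F E i k := by
  induction j, hij using Nat.le_induction with
  | base => exact subset_rfl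
  | succ j _ ih => exact (G_succ I F E j k).trans ih

lemma InfP_pred {H : ℕ → Set Q} {k : ℕ} {q q' : Q} (hq : q ∈ H k) (he : E k q q')
    (hq' : q' ∈ InfP E H (k + 1)) : q ∈ InfP E H k := by
  obtain ⟨ρ, hρ, h⟩ := hq'
  refine ⟨Function.update ρ k q, by simp, fun i hi => ?_⟩
  rcases hi.eq_or_lt with rfl | hlt
  · simp [hρ, hq, he]
  · have h1 : i ≠ k := by omega
    have h2 : i + 1 ≠ k := by omega
    simpa [Function.update_of_ne h1, Function.update_of_ne h2] using h i hlt

lemma G_pred (j : ℕ) : ∀ k q q', q ∈ Reach I E k → E k q q' → q' ∈ G I F E j (k + 1) →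
    q ∈ G I F E j k := by
  induction j with
  | zero => intro k q q' h _ _; exact h
  | succ j ih =>
    intro k q q' hq he hq'
    have hqj := ih k q q' hq he (G_succ I F E j _ hq')
    by_cases hj : Even j
    · rw [G_even I F E hj] at hq' ⊢
      exact InfP_pred E hqj he hq'
    · rw [G_odd I F E hj] at hq' ⊢
      obtain ⟨d, hd⟩ := hq'
      exact ⟨d + 1, hqj, q', he, hd⟩

lemma InfP_succ {H : ℕ → Set Q} {k : ℕ} {q : Q} (hq : q ∈ InfP E H k) :
    ∃ q' ∈ InfP E H (k + 1), E k q q' := by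
  obtain ⟨ρ, rfl, h⟩ := hq
  exact ⟨ρ (k + 1), ⟨ρ, rfl, fun i hi => h i (by omega)⟩, (h k le_rfl).2⟩

lemma extend_run (k : ℕ) : ∀ ρ : ℕ → Q, ρ k ∈ Reach I E k →
    (∀ i, k ≤ i → E i (ρ i) (ρ (i + 1))) →
    ∃ ρ' : ℕ → Q, ρ' 0 ∈ I ∧ (∀ i, E i (ρ' i) (ρ' (i + 1))) ∧ ∀ i, k ≤ i → ρ' i = ρ i := by
  induction k with
  | zero => intro ρ h0 h; exact ⟨ρ, h0, fun i => h i (Nat.zero_le _), fun _ _ => rfl⟩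
  | succ k ih =>
    intro ρ h0 h
    obtain ⟨q, hq, he⟩ := h0
    obtain ⟨ρ', h1, h2, h3⟩ := ih (Function.update ρ k q) (by simpa using hq) (by
      intro i hi
      rcases hi.eq_or_lt with rfl | hlt
      · simpa using he
      · have h1 : i ≠ k := by omega
        have h2 : i + 1 ≠ k := by omega
        simpa [Function.update_of_ne h1, Function.update_of_ne h2] using h i hlt)
    refine ⟨ρ', h1, h2, fun i hi => ?_⟩
    rw [h3 i (by omega), Function.update_of_ne (by omega)]

/-- no accepting run -/
def NoAcc : Prop := ∀ ρ : ℕ → Q, ρ 0 ∈ I → (∀ i, E i (ρ i) (ρ (i + 1))) →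
    ¬ ∀ n, ∃ m, n ≤ m ∧ ρ m ∈ F

lemma exists_Ffree (hN : NoAcc I F E) {H : ℕ → Set Q} (hR : ∀ k, H k ⊆ Reach I E k)
    (hs : ∀ k, ∀ q ∈ H k, ∃ q' ∈ H (k + 1), E k q q') {k0 : ℕ} {q0 : Q} (h0 : q0 ∈ H k0) :
    ∃ k q, q ∈ H k ∧ ∀ d, ¬ FR F E H d k q := by
  by_contra hcon
  push Not at hcon
  have hstep : ∀ k q, q ∈ H k → ∃ q', q' ∈ H (k + 1) ∧ E k q q' ∧
      ∀ d, FR F E H d k q → q ∈ F ∨ ∃ d', d' < d ∧ FR F E H d' (k + 1) q' := by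
    intro k q hq
    have hex := hcon k q hq
    have hsp := Nat.find_spec hex
    have hmin : ∀ d, FR F E H d k q → Nat.find hex ≤ d := fun d hd => Nat.find_min' hex hd
    generalize Nat.find hex = d0 at hsp hmin
    cases d0 with
    | zero =>
      obtain ⟨q', h1, h2⟩ := hs k q hq
      exact ⟨q', h1, h2, fun _ _ => Or.inl hsp.2⟩
    | succ d0 =>
      obtain ⟨_, q', h1, h2⟩ := hsp
      exact ⟨q', FR_mem F E h2, h1, fun d hd => Or.inr ⟨d0, hmin d hd, h2⟩⟩
  choose! nx hnx using hstep
  let τ : ℕ → Q := fun t => Nat.rec q0 (fun t q => nx (k0 + t) q) t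
  have hτ : ∀ t, τ t ∈ H (k0 + t) := by
    intro t
    induction t with
    | zero => exact h0
    | succ t ih => exact (hnx (k0 + t) _ ih).1
  have hF : ∀ d t, FR F E H d (k0 + t) (τ t) → ∃ m, t ≤ m ∧ τ m ∈ F := by
    intro d
    induction d using Nat.strong_induction_on with
    | _ d ih =>
      intro t ht
      rcases (hnx (k0 + t) _ (hτ t)).2.2 d ht with h | ⟨d', hd', h⟩
      · exact ⟨t, le_rfl, h⟩
      · obtain ⟨m, hm, hmF⟩ := ih d' hd' (t + 1) h
        exact ⟨m, by omega, hmF⟩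
  obtain ⟨ρ, h1, h2, h3⟩ := extend_run I E k0 (fun i => τ (i - k0))
    (by have := hR _ h0; simp only [Nat.sub_self]; exact this) (by
      intro i hi
      obtain ⟨t, rfl⟩ := Nat.exists_eq_add_of_le hi
      have e1 : k0 + t - k0 = t := by omega
      have e2 : k0 + t + 1 - k0 = t + 1 := by omega
      simp only [e1, e2]
      exact (hnx (k0 + t) _ (hτ t)).2.1)
  refine hN ρ h1 h2 fun n => ?_
  obtain ⟨d, hd⟩ := hcon (k0 + n) (τ n) (hτ n)
  obtain ⟨m, hm, hmF⟩ := hF d n hd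
  refine ⟨k0 + m, by omega, ?_⟩
  rw [h3 _ (by omega)]
  simpa using hmF

lemma width [Fintype Q] (hN : NoAcc I F E) (i : ℕ)
    (hne : ∃ k q, q ∈ G I F E (2 * i) k) :
    ∃ L, ∀ k, L ≤ k → (G I F E (2 * i) k).ncard + i ≤ Fintype.card Q := by
  induction i with
  | zero =>
    refine ⟨0, fun k _ => ?_⟩
    have := Set.ncard_le_card (G I F E (2 * 0) k)
    simpa [Nat.card_eq_fintype_card] using this
  | succ i ih =>
    obtain ⟨k0, q0, h0⟩ := hne
    have he : Even (2 * i) := even_two_mul i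
    have ho : ¬ Even (2 * i + 1) := by simp
    have e2 : 2 * (i + 1) = 2 * i + 1 + 1 := by ring
    rw [e2] at h0 ⊢
    obtain ⟨L, hL⟩ := ih ⟨k0, q0, G_anti I F E (by omega) _ h0⟩
    have h1 := G_succ I F E _ _ h0
    obtain ⟨k, q, hq, hfr⟩ := exists_Ffree I F E hN (H := G I F E (2 * i + 1))
      (fun k => G_anti I F E (Nat.zero_le _) k)
      (fun k q hq => by rw [G_even I F E he] at hq ⊢; exact InfP_succ E hq) h1
    have hq' := hq
    rw [G_even I F E he] at hq'
    obtain ⟨ρ, hρ, hp⟩ := hq'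
    have hmem : ∀ i', k ≤ i' → ρ i' ∈ G I F E (2 * i + 1) i' := by
      intro i' hi'
      rw [G_even I F E he]
      exact ⟨ρ, rfl, fun i'' h => hp i'' (hi'.trans h)⟩
    have hno : ∀ i', k ≤ i' → ∀ d, ¬ FR F E (G I F E (2 * i + 1)) d i' (ρ i') := by
      intro i' hi'
      induction i', hi' using Nat.le_induction with
      | base => rw [hρ]; exact hfr
      | succ i' hi' ih' =>
        intro d hd
        exact ih' (d + 1) ⟨hmem i' hi', _, (hp i' hi').2, hd⟩
    refine ⟨max L k, fun m hm => ?_⟩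
    have hlt : (G I F E (2 * i + 1 + 1) m).ncard < (G I F E (2 * i) m).ncard := by
      apply Set.ncard_lt_ncard _ (Set.toFinite _)
      refine ⟨G_anti I F E (by omega) m, fun hsub => ?_⟩
      have hkm : k ≤ m := (le_max_right _ _).trans hm
      have := hsub (G_succ I F E _ _ (hmem m hkm))
      rw [G_odd I F E ho] at this
      obtain ⟨d, hd⟩ := this
      exact hno m hkm d hd
    have := hL m ((le_max_left _ _).trans hm)
    omega

lemma G_empty [Fintype Q] (hN : NoAcc I F E) (k : ℕ) (q : Q) :
    q ∉ G I F E (2 * Fintype.card Q + 1) k := by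
  intro hq
  obtain ⟨L, hL⟩ := width I F E hN (Fintype.card Q) ⟨k, q, G_succ I F E _ _ hq⟩
  rw [G_even I F E (even_two_mul _)] at hq
  obtain ⟨ρ, hρ, hp⟩ := hq
  have h1 := (hp (max L k) (le_max_right _ _)).1
  have h2 := hL (max L k) (le_max_left _ _)
  have h3 : (G I F E (2 * Fintype.card Q) (max L k)).ncard = 0 := by omega
  rw [Set.ncard_eq_zero (Set.toFinite _)] at h3
  rw [h3] at h1
  exact h1

lemma exists_rank [Fintype Q] (hN : NoAcc I F E) :
    ∃ f : ℕ → Q → Fin (2 * Fintype.card Q + 2),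
      (∀ q ∈ I, (f 0 q : ℕ) ≤ 2 * Fintype.card Q) ∧
      (∀ k q q', E k q q' → (f (k + 1) q' : ℕ) ≤ f k q) ∧
      (∀ k, ∀ q ∈ F, (f k q : ℕ) ≤ 2 * Fintype.card Q → Even (f k q : ℕ)) ∧
      (∀ (ρ : ℕ → Q) (N j : ℕ), Even j → (∀ i, N ≤ i → (f i (ρ i) : ℕ) = j) →
        (∀ i, N ≤ i → E i (ρ i) (ρ (i + 1))) → False) := by
  set n := Fintype.card Q with hn
  have hr : ∀ k q, ∃ r, r < 2 * n + 2 ∧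
      ((q ∈ Reach I E k ∧ r ≤ 2 * n ∧ q ∈ G I F E r k ∧ q ∉ G I F E (r + 1) k) ∨
        (q ∉ Reach I E k ∧ r = 2 * n + 1)) := by
    intro k q
    by_cases hq : q ∈ Reach I E k
    · have hex : ∃ r, q ∉ G I F E (r + 1) k := ⟨2 * n, G_empty I F E hN k q⟩
      have hle : Nat.find hex ≤ 2 * n := Nat.find_min' hex (G_empty I F E hN k q)
      refine ⟨Nat.find hex, by omega, Or.inl ⟨hq, hle, ?_, Nat.find_spec hex⟩⟩
      rcases h : Nat.find hex with _ | r
      · exact hq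
      · have := Nat.find_min hex (m := r) (by omega)
        simpa using this
    · exact ⟨2 * n + 1, by omega, Or.inr ⟨hq, rfl⟩⟩
  choose r hlt hr using hr
  refine ⟨fun k q => ⟨r k q, hlt k q⟩, ?_, ?_, ?_, ?_⟩
  · intro q hq
    rcases hr 0 q with h | h
    · exact h.2.1
    · exact absurd hq h.1
  · intro k q q' he
    simp only
    rcases hr k q with h | h
    · have hq' : q' ∈ Reach I E (k + 1) := ⟨q, h.1, he⟩
      rcases hr (k + 1) q' with h' | h'
      · by_contra hcon
        exact h.2.2.2 (G_pred I F E _ k q q' h.1 he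
          (G_anti I F E (by omega) _ h'.2.2.1))
      · exact absurd hq' h'.1
    · have := hlt (k + 1) q'
      omega
  · intro k q hq hle
    simp only at hle ⊢
    rcases hr k q with h | h
    · by_contra ho
      apply h.2.2.2
      rw [G_odd I F E ho]
      exact ⟨0, h.2.2.1, hq⟩
    · omega
  · intro ρ N j hj hc he
    simp only at hc
    have hmem : ∀ i, N ≤ i → ρ i ∈ G I F E j i ∧ ρ i ∉ G I F E (j + 1) i := by
      intro i hi
      have := hc i hi
      rcases hr i (ρ i) with h | h
      · rw [this] at h; exact h.2.2
      · exfalso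
        rw [← this, h.2] at hj
        simp at hj
    apply (hmem N le_rfl).2
    rw [G_even I F E hj]
    exact ⟨ρ, rfl, fun i hi => ⟨(hmem i hi).1, he i hi⟩⟩

end DAG

section Constr
variable {σ Q : Type} [Fintype Q]

/-- next obligation set -/
def nextO (A : NBW σ Q) (O : Set Q) (f' : Q → Fin (2 * Fintype.card Q + 2)) (a : σ) : Set Q :=
  {q' | Even (f' q' : ℕ) ∧ (O = ∅ ∨ ∃ q ∈ O, q' ∈ A.trans q a)}

/-- the rank-based complement automaton -/
def compl (A : NBW σ Q) : NBW σ ((Q → Fin (2 * Fintype.card Q + 2)) × Set Q) where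
  init := {s | (∀ q ∈ A.init, (s.1 q : ℕ) ≤ 2 * Fintype.card Q) ∧ s.2 = ∅}
  trans s a := {s' | (∀ q ∈ A.acc, (s.1 q : ℕ) ≤ 2 * Fintype.card Q → Even (s.1 q : ℕ)) ∧
    (∀ q q', q' ∈ A.trans q a → (s'.1 q' : ℕ) ≤ s.1 q) ∧ s'.2 = nextO A s.2 s'.1 a}
  acc := {s | s.2 = ∅}

lemma compl_sound (A : NBW σ Q) (w : ℕ → σ) (hB : w ∈ (compl A).Lang) : w ∉ A.Lang := by
  rintro ⟨ρ, ⟨h0, hs⟩, hacc⟩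
  obtain ⟨s, ⟨b0, bs⟩, bacc⟩ := hB
  have hmono : ∀ k, ((s (k + 1)).1 (ρ (k + 1)) : ℕ) ≤ (s k).1 (ρ k) :=
    fun k => (bs k).2.1 _ _ (hs k)
  have hle : ∀ k, ((s k).1 (ρ k) : ℕ) ≤ 2 * Fintype.card Q := by
    intro k
    induction k with
    | zero => exact b0.1 _ h0
    | succ k ih => exact (hmono k).trans ih
  obtain ⟨N, -, hN⟩ := stab (fun k => ((s k).1 (ρ k) : ℕ)) 0 (fun k _ => hmono k)
  obtain ⟨m, hm, hmF⟩ := hacc N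
  have hev : Even ((s N).1 (ρ N) : ℕ) := by
    rw [← hN m hm]
    exact (bs m).1 _ hmF (hle m)
  obtain ⟨M, hM, hMO⟩ := bacc N
  have hin : ∀ k, M + 1 ≤ k → ρ k ∈ (s k).2 := by
    intro k hk
    induction k, hk using Nat.le_induction with
    | base =>
      rw [(bs M).2.2]
      exact ⟨by rw [hN _ (by omega)]; exact hev, Or.inl hMO⟩
    | succ k hk ih =>
      rw [(bs k).2.2]
      exact ⟨by rw [hN _ (by omega)]; exact hev, Or.inr ⟨_, ih, hs k⟩⟩
  obtain ⟨k, hk, hkO⟩ := bacc (M + 1)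
  have := hin k hk
  rw [show (s k).2 = ∅ from hkO] at this
  exact this

lemma compl_complete (A : NBW σ Q) (w : ℕ → σ) (hA : w ∉ A.Lang) : w ∈ (compl A).Lang := by
  have hN : NoAcc A.init A.acc (fun k q q' => q' ∈ A.trans q (w k)) :=
    fun ρ h0 h hacc => hA ⟨ρ, ⟨h0, h⟩, hacc⟩
  obtain ⟨f, f0, f1, f2, f3⟩ := exists_rank _ _ _ hN
  let O : ℕ → Set Q := fun k => Nat.rec ∅ (fun k S => nextO A S (f (k + 1)) (w k)) k
  have hO : ∀ k, O (k + 1) = nextO A (O k) (f (k + 1)) (w k) := fun k => rfl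
  have hOe : ∀ k, ∀ q ∈ O k, Even (f k q : ℕ) := by
    intro k q hq
    cases k with
    | zero => exact hq.elim
    | succ k => exact hq.1
  refine ⟨fun k => (f k, O k), ⟨⟨f0, rfl⟩, fun k => ⟨f2 k, f1 k, hO k⟩⟩, fun M => ?_⟩
  by_contra hcon
  push Not at hcon
  have hne : ∀ m, M ≤ m → (O m).Nonempty := fun m hm =>
    Set.nonempty_iff_ne_empty.mpr (hcon m hm)
  obtain ⟨τ, hτ, hτE⟩ := konig (fun k => O (M + k)) (fun k q q' => q' ∈ A.trans q (w (M + k)))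
    (fun k => hne _ (by omega)) (by
      intro k q' hq'
      rcases hq'.2 with h | h
      · exact absurd h (hcon _ (Nat.le_add_right M k))
      · exact h)
  let ρ : ℕ → Q := fun i => τ (i - M)
  have hρ : ∀ i, M ≤ i → ρ i ∈ O i ∧ ρ (i + 1) ∈ A.trans (ρ i) (w i) := by
    intro i hi
    obtain ⟨t, rfl⟩ := Nat.exists_eq_add_of_le hi
    have e1 : M + t - M = t := by omega
    have e2 : M + t + 1 - M = t + 1 := by omega
    simp only [ρ, e1, e2]
    exact ⟨hτ t, hτE t⟩
  obtain ⟨N, hMN, hst⟩ := stab (fun k => (f k (ρ k) : ℕ)) M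
    (fun k hk => f1 k _ _ (hρ k hk).2)
  exact f3 ρ N _ (hOe N _ (hρ N hMN).1) hst (fun i hi => (hρ i (hMN.trans hi)).2)

/-- transport along an equivalence of state spaces -/
def transport {P R : Type} (B : NBW σ P) (e : P ≃ R) : NBW σ R where
  init := {r | e.symm r ∈ B.init}
  trans r a := {r' | e.symm r' ∈ B.trans (e.symm r) a}
  acc := {r | e.symm r ∈ B.acc}

lemma transport_lang {P R : Type} (B : NBW σ P) (e : P ≃ R) : (transport B e).Lang = B.Lang := by
  ext w
  constructor
  · rintro ⟨ρ, ⟨h0, h1⟩, h2⟩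
    exact ⟨fun i => e.symm (ρ i), ⟨h0, h1⟩, h2⟩
  · rintro ⟨ρ, ⟨h0, h1⟩, h2⟩
    refine ⟨fun i => e (ρ i), ⟨?_, ?_⟩, ?_⟩
    · simpa [transport] using h0
    · simpa [transport] using h1
    · simpa [transport] using h2

end Constr

end NBW.Aux

/-- Every complete NBW with `n` states has a complementary NBW with at most
`2 ^ n * (2 * n + 2) ^ n` states. -/
theorem NBW.nbw_complement_rank (σ Q : Type) [Fintype σ] [Nonempty σ] [Fintype Q]
    (A : NBW σ Q) (hc : A.Complete) :
    ∃ (m : ℕ) (B : NBW σ (Fin m)),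
      m ≤ 2 ^ Fintype.card Q * (2 * Fintype.card Q + 2) ^ Fintype.card Q ∧
      B.Lang = Set.univ \ A.Lang := by
  refine ⟨_, NBW.Aux.transport (NBW.Aux.compl A) (Fintype.equivFin _), ?_, ?_⟩
  · apply le_of_eq
    simp [Fintype.card_prod, Fintype.card_set, mul_comm]
  · rw [NBW.Aux.transport_lang]
    ext w
    simp only [Set.mem_sdiff, Set.mem_univ, true_and]
    exact ⟨NBW.Aux.compl_sound A w, NBW.Aux.compl_complete A w⟩
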